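/- arXiv:2409.17748 — 3 statements merged into one kernel-verified Lean document; each statement's English description precedes it below -/
import Mathlib

section
/- There exists a nowhere dense set F ⊆ ℤ^ω such that for every ω-Silver tree T ⊆ ℤ^{<ω}, the set F + [T] is not meager. -/
open Pointwise Filter

/-- The length-`n` initial segment of `x : ℕ → ℤ`, as a finite sequence. -/
def res (x : ℕ → ℤ) (n : ℕ) : List ℤ := List.ofFn (fun i : Fin n => x (i : ℕ))

/-- A tree on `ℤ`: a set of finite integer sequences closed under initial segments. -/
def IsTree (T : Set (List ℤ)) : Prop := ∀ σ ∈ T, ∀ τ, τ <+: σ → τ ∈ T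

/-- The set of infinite branches of a tree. -/
def branches (T : Set (List ℤ)) : Set (ℕ → ℤ) := {x | ∀ n, res x n ∈ T}

/-- `σ` is a splitting node of `T` (at least two immediate successors). -/
def Splits (T : Set (List ℤ)) (σ : List ℤ) : Prop :=
  ∃ i j : ℤ, i ≠ j ∧ σ ++ [i] ∈ T ∧ σ ++ [j] ∈ T

/-- `σ` is an ω-splitting node of `T` (infinitely many immediate successors). -/
def OmegaSplits (T : Set (List ℤ)) (σ : List ℤ) : Prop :=
  {i : ℤ | σ ++ [i] ∈ T}.Infinite

/-- Perfect tree: a nonempty tree in which every node has a splitting extension. -/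
def IsPerfect (T : Set (List ℤ)) : Prop :=
  IsTree T ∧ T.Nonempty ∧ ∀ σ ∈ T, ∃ τ ∈ T, σ <+: τ ∧ Splits T τ

/-- Uniformly perfect tree: perfect, and on every level either all nodes split
or none do. -/
def IsUniformlyPerfect (T : Set (List ℤ)) : Prop :=
  IsPerfect T ∧ ∀ n : ℕ,
    (∀ σ ∈ T, σ.length = n → Splits T σ) ∨ (∀ σ ∈ T, σ.length = n → ¬ Splits T σ)

/-- Miller tree: a nonempty tree in which every node has an ω-splitting extension. -/
def IsMiller (T : Set (List ℤ)) : Prop :=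
  IsTree T ∧ T.Nonempty ∧ ∀ σ ∈ T, ∃ τ ∈ T, σ <+: τ ∧ OmegaSplits T τ

/-- Laver tree: a tree with a stem `σ` such that every node is an initial
segment of the stem, or extends it and is ω-splitting. -/
def IsLaver (T : Set (List ℤ)) : Prop :=
  IsTree T ∧ ∃ σ ∈ T, ∀ τ ∈ T, τ <+: σ ∨ (σ <+: τ ∧ OmegaSplits T τ)

/-- The ω-Silver tree with parameters `A` (set of free coordinates) and `xT`. -/
def silverTree (A : Set ℕ) (xT : ℕ → ℤ) : Set (List ℤ) :=
  {σ : List ℤ | ∀ n (h : n < σ.length), n ∉ A → σ.get ⟨n, h⟩ = xT n}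

/-- ω-Silver tree: `σ ∈ T` iff `σ` agrees with `xT` outside an infinite set `A`. -/
def IsOmegaSilver (T : Set (List ℤ)) : Prop :=
  ∃ A : Set ℕ, A.Infinite ∧ ∃ xT : ℕ → ℤ, T = silverTree A xT

/-- Membership in the σ-ideal `M₋`: `F` is covered by a set of the form
`{x : ∀∞ n, x↾Iₙ ≠ x_A↾Iₙ}` where the consecutive intervals `Iₙ = [a n, a (n+1))`
(`a` strictly monotone, `a 0 = 0`) partition `ω`. -/
def MemMminus (F : Set (ℕ → ℤ)) : Prop :=
  ∃ xA : ℕ → ℤ, ∃ a : ℕ → ℕ, a 0 = 0 ∧ StrictMono a ∧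
    F ⊆ {x | ∀ᶠ n in Filter.atTop, ∃ k, a n ≤ k ∧ k < a (n + 1) ∧ x k ≠ xA k}

/-- Membership in the ideal `nwd₋` generated by the sets
`{x : ∀ n, x↾Iₙ ≠ x_A↾Iₙ}`: `F` is covered by finitely many generators. -/
def MemNwdMinus (F : Set (ℕ → ℤ)) : Prop :=
  ∃ (m : ℕ) (xA : Fin m → ℕ → ℤ) (a : Fin m → ℕ → ℕ),
    (∀ i, a i 0 = 0 ∧ StrictMono (a i)) ∧
    F ⊆ ⋃ i, {x | ∀ n, ∃ k, a i n ≤ k ∧ k < a i (n + 1) ∧ x k ≠ xA i k}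

/-- The basic clopen set `[σ]` of all extensions of `σ`. -/
def cyl (σ : List ℤ) : Set (ℕ → ℤ) := {x | res x σ.length = σ}

/-- Fake null set: for every `ε > 0` it is covered by countably many cylinders
`[σₙ]` with `Σₙ 2^{-|σₙ|} < ε`. -/
def IsFakeNull (F : Set (ℕ → ℤ)) : Prop :=
  ∀ ε : ℝ, 0 < ε → ∃ σ : ℕ → List ℤ,
    Summable (fun n => (1 : ℝ) / 2 ^ (σ n).length) ∧
    (∑' n, (1 : ℝ) / 2 ^ (σ n).length) < ε ∧
    F ⊆ ⋃ n, cyl (σ n)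

/-- `iterSum F B n` is the algebraic sum `F + B + B + ⋯ + B` (`n` copies of `B`). -/
def iterSum (F B : Set (ℕ → ℤ)) : ℕ → Set (ℕ → ℤ)
  | 0 => F
  | n + 1 => iterSum F B n + B

/-- The sequences in which no initial segment `z↾n` is followed by a block of zeros
of length `1 + ∑ i < n, |z i|`. -/
def shortZeroBlocks : Set (ℕ → ℤ) :=
  {z | ∀ n, ∃ k < 1 + ∑ i ∈ Finset.range n, (z i).natAbs, z (n + k) ≠ 0}

lemma isClosed_shortZeroBlocks : IsClosed shortZeroBlocks := by
  have hcoord : ∀ i, Continuous fun z : ℕ → ℤ => z i := fun i => continuous_apply i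
  have h : shortZeroBlocksᶜ = ⋃ n : ℕ, ⋃ m : ℕ,
      {z : ℕ → ℤ | 1 + ∑ i ∈ Finset.range n, (z i).natAbs = m} ∩
        ⋂ k ∈ Finset.range m, {z : ℕ → ℤ | z (n + k) = 0} := by
    ext z
    simp [shortZeroBlocks]
  rw [← isOpen_compl_iff, h]
  refine isOpen_iUnion fun n => isOpen_iUnion fun m => IsOpen.inter ?_ ?_
  · have hc : Continuous fun z : ℕ → ℤ => 1 + ∑ i ∈ Finset.range n, (z i).natAbs :=
      continuous_const.add (continuous_finsetSum _ fun i _ =>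
        (continuous_of_discreteTopology (f := Int.natAbs)).comp (hcoord i))
    exact (isOpen_discrete {m}).preimage hc
  · exact isOpen_biInter_finset fun k _ => (isOpen_discrete {(0 : ℤ)}).preimage (hcoord (n + k))

lemma isNowhereDense_shortZeroBlocks : IsNowhereDense shortZeroBlocks := by
  rw [isClosed_shortZeroBlocks.isNowhereDense_iff, Set.eq_empty_iff_forall_notMem]
  intro z hz
  have ht : Tendsto (fun n i => if i < n then z i else 0) atTop (nhds z) := by
    refine tendsto_pi_nhds.2 fun i => tendsto_const_nhds.congr' ?_
    filter_upwards [eventually_gt_atTop i] with n hn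
    simp [hn]
  obtain ⟨n, hn⟩ := (ht.eventually (mem_interior_iff_mem_nhds.1 hz)).exists
  obtain ⟨k, -, hk⟩ := hn n
  simp at hk

/-- A sequence avoids long blocks of zeros if it is nonzero below some element of `A`, and
its value at each element of `A` exceeds some later element of `A`. -/
lemma mem_shortZeroBlocks_of_next {A : Set ℕ} (next : ℕ → ℕ) (hnext : ∀ n, n ≤ next n)
    (hmem : ∀ n, next n ∈ A) {z : ℕ → ℤ} (hA : ∀ a ∈ A, z a = next (a + 1) + 1)
    (hz : ∀ i < next 0, z i ≠ 0) : z ∈ shortZeroBlocks := by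
  have hne : ∀ a ∈ A, z a ≠ 0 := fun a ha => by rw [hA a ha]; omega
  have key : ∀ n, n ≤ next 0 ∨ ∃ a ∈ A, a < n ∧ n ≤ next (a + 1) := by
    intro n
    induction n with
    | zero => exact .inl (Nat.zero_le _)
    | succ n ih =>
      by_cases hn : n ∈ A
      · exact .inr ⟨n, hn, n.lt_succ_self, hnext _⟩
      · have hlt : ∀ m, n ≤ next m → n + 1 ≤ next m := fun m h =>
          lt_of_le_of_ne h fun he => hn (he ▸ hmem m)
        rcases ih with h | ⟨a, ha, han, h⟩
        · exact .inl (hlt _ h)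
        · exact .inr ⟨a, ha, han.trans n.lt_succ_self, hlt _ h⟩
  intro n
  rcases key n with h | ⟨a, ha, han, h⟩
  · refine ⟨0, by omega, ?_⟩
    rcases h.lt_or_eq with h | h
    · exact hz n h
    · exact hne n (h ▸ hmem 0)
  · refine ⟨next (a + 1) - n, ?_, ?_⟩
    · have hle := Finset.single_le_sum (f := fun i => (z i).natAbs) (fun i _ => Nat.zero_le _)
        (Finset.mem_range.2 han)
      have hza := hA a ha
      omega
    · rw [Nat.add_sub_cancel' h]
      exact hne _ (hmem _)

lemma mem_branches_silverTree {A : Set ℕ} {xT t : ℕ → ℤ} (h : ∀ n ∉ A, t n = xT n) :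
    t ∈ branches (silverTree A xT) := by
  intro m n hn hnA
  simpa [res] using h n hnA

/-- There is a nowhere dense `F ⊆ ℤ^ω` such that `F + [T]` is not
meager for every ω-Silver tree `T`. -/
theorem stmt8 : ∃ F : Set (ℕ → ℤ), IsNowhereDense F ∧
    ∀ T : Set (List ℤ), IsOmegaSilver T → ¬ IsMeagre (F + branches T) := by
  classical
  refine ⟨shortZeroBlocks, isNowhereDense_shortZeroBlocks, ?_⟩
  rintro _ ⟨A, hAinf, xT, rfl⟩ hmeagre
  choose next hmem hnext using fun n => hAinf.exists_gt n
  have hopen : IsOpen (⋂ i ∈ Finset.range (next 0), {w : ℕ → ℤ | w i ≠ xT i}) :=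
    isOpen_biInter_finset fun i _ =>
      isOpen_ne_fun (continuous_apply i) continuous_const
  have hsub : (⋂ i ∈ Finset.range (next 0), {w : ℕ → ℤ | w i ≠ xT i}) ⊆
      shortZeroBlocks + branches (silverTree A xT) := by
    intro w hw
    simp only [Finset.mem_range, Set.mem_iInter, Set.mem_ofPred_eq] at hw
    let z : ℕ → ℤ := fun i => if i ∈ A then next (i + 1) + 1 else w i - xT i
    refine ⟨z, ?_, w - z, ?_, add_sub_cancel z w⟩
    · refine mem_shortZeroBlocks_of_next next (fun n => (hnext n).le) hmem
        (fun a ha => by simp [z, ha]) fun i hi => ?_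
      by_cases hiA : i ∈ A
      · simp only [z, hiA, if_true]
        omega
      · simpa [z, hiA] using sub_ne_zero.2 (hw i hi)
    · exact mem_branches_silverTree fun n hn => by simp [z, hn]
  refine not_isMeagre_of_isOpen hopen ⟨fun i => xT i + 1, ?_⟩ (hmeagre.mono hsub)
  simp
end

section
/- For every fake null set F ⊆ ℤ^ω and every perfect tree T ⊆ ℤ^{<ω} there exists a perfect tree T' ⊆ T such that for every n ≥ 1 the n-fold sum F + [T'] + [T'] + ⋯ + [T'] is fake null; moreover, if T is uniformly perfect then T' can be chosen uniformly perfect. -/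
open Pointwise Filter

/-! ### Initial segments -/

@[simp]
lemma length_res (x : ℕ → ℤ) (n : ℕ) : (res x n).length = n := by simp [res]

lemma res_add (x y : ℕ → ℤ) (n : ℕ) :
    res (x + y) n = List.zipWith (· + ·) (res x n) (res y n) := by
  apply List.ext_getElem <;> simp [res]

/-! ### Covers by cylinders -/

open scoped ENNReal

/-- The weight `2^{-|σ|}` of a finite sequence. -/
noncomputable def weight (σ : List ℤ) : ℝ≥0∞ := 2⁻¹ ^ σ.length

lemma ofReal_one_div_two_pow (n : ℕ) : ENNReal.ofReal (1 / 2 ^ n) = 2⁻¹ ^ n := by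
  rw [one_div, ← inv_pow, ENNReal.ofReal_pow (by positivity), ENNReal.ofReal_inv_of_pos (by simp)]
  simp

lemma IsFakeNull.exists_cover {F : Set (ℕ → ℤ)} (hF : IsFakeNull F) {ε : ℝ} (hε : 0 < ε) :
    ∃ σ : ℕ → List ℤ, ∑' n, weight (σ n) ≤ ENNReal.ofReal ε ∧ F ⊆ ⋃ n, cyl (σ n) := by
  obtain ⟨σ, hs, hlt, hcov⟩ := hF ε hε
  refine ⟨σ, ?_, hcov⟩
  simp only [weight, ← ofReal_one_div_two_pow]
  rw [← ENNReal.ofReal_tsum_of_nonneg (fun n => by positivity) hs]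
  exact ENNReal.ofReal_le_ofReal hlt.le

/-- Covers indexed by arbitrary countable types suffice for being fake null. -/
lemma isFakeNull_of_countable_cover {A : Set (ℕ → ℤ)}
    (h : ∀ ε : ℝ≥0∞, ε ≠ 0 → ∃ (ι : Type) (_ : Countable ι) (τ : ι → List ℤ),
      ∑' i, weight (τ i) < ε ∧ A ⊆ ⋃ i, cyl (τ i)) : IsFakeNull A := by
  intro ε hε
  obtain ⟨ι, _, τ, hlt, hcov⟩ := h (ENNReal.ofReal (ε / 2)) (by simpa using hε)
  obtain ⟨N, hN⟩ := exists_pow_lt_of_lt_one (show 0 < ε / 4 by positivity)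
    (show (2⁻¹ : ℝ) < 1 by norm_num)
  -- pad the index type so that it is infinite
  let ρ : ι ⊕ ℕ → List ℤ := Sum.elim τ fun n => List.replicate (n + N) 0
  have hpad : ∑' n : ℕ, weight (List.replicate (n + N) 0) ≤ ENNReal.ofReal (ε / 2) := by
    simp only [weight, List.length_replicate, pow_add, ENNReal.tsum_mul_right,
      ENNReal.tsum_geometric_two]
    rw [← ofReal_one_div_two_pow, ← ENNReal.ofReal_ofNat, ← ENNReal.ofReal_mul (by simp)]
    apply ENNReal.ofReal_le_ofReal
    rw [one_div, ← inv_pow]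
    linarith
  have hρ : ∑' i, weight (ρ i) < ENNReal.ofReal ε := by
    rw [ENNReal.summable.tsum_sum ENNReal.summable]
    calc _ < ENNReal.ofReal (ε / 2) + ENNReal.ofReal (ε / 2) :=
          ENNReal.add_lt_add_of_lt_of_le (hpad.trans_lt ENNReal.ofReal_lt_top).ne hlt hpad
      _ = _ := by rw [← ENNReal.ofReal_add (by positivity) (by positivity), add_halves]
  obtain ⟨_⟩ := nonempty_denumerable (ι ⊕ ℕ)
  let e : ℕ ≃ ι ⊕ ℕ := (Denumerable.eqv _).symm
  have hsum : ∑' n, ENNReal.ofReal (1 / 2 ^ (ρ (e n)).length) < ENNReal.ofReal ε := by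
    simp only [ofReal_one_div_two_pow]
    exact (e.tsum_eq fun i => weight (ρ i)).trans_lt hρ
  have hs : Summable fun n => (1 : ℝ) / 2 ^ (ρ (e n)).length := by
    have := ENNReal.summable_toReal (hsum.trans ENNReal.ofReal_lt_top).ne
    refine this.congr fun n => ?_
    rw [ENNReal.toReal_ofReal (by positivity)]
  refine ⟨fun n => ρ (e n), hs, ?_, fun x hx => ?_⟩
  · rw [← ENNReal.ofReal_tsum_of_nonneg (fun n => by positivity) hs] at hsum
    exact (ENNReal.ofReal_lt_ofReal_iff hε).1 hsum
  · obtain ⟨i, hi⟩ := Set.mem_iUnion.1 (hcov hx)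
    refine Set.mem_iUnion.2 ⟨e.symm (Sum.inl i), ?_⟩
    simpa [ρ] using hi

/-- All sums of `σ` with `n` elements of `D`. -/
def sumNodes (D : Finset (List ℤ)) (σ : List ℤ) : ℕ → Finset (List ℤ)
  | 0 => {σ}
  | n + 1 => Finset.image₂ (List.zipWith (· + ·)) (sumNodes D σ n) D

lemma card_sumNodes_le (D : Finset (List ℤ)) (σ : List ℤ) (n : ℕ) :
    (sumNodes D σ n).card ≤ D.card ^ n := by
  induction n with
  | zero => simp [sumNodes]
  | succ n ih =>
    rw [pow_succ]
    exact (Finset.card_image₂_le _ _ _).trans (Nat.mul_le_mul_right _ ih)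

lemma length_of_mem_sumNodes {D : Finset (List ℤ)} {σ : List ℤ}
    (hD : ∀ d ∈ D, d.length = σ.length) {n : ℕ} {τ : List ℤ} (hτ : τ ∈ sumNodes D σ n) :
    τ.length = σ.length := by
  induction n generalizing τ with
  | zero => simp_all [sumNodes]
  | succ n ih =>
    obtain ⟨a, ha, d, hd, rfl⟩ := Finset.mem_image₂.1 hτ
    simp [ih ha, hD d hd]

lemma exists_res_mem_sumNodes {F B : Set (ℕ → ℤ)} {D : ℕ → Finset (List ℤ)}
    (hD : ∀ x ∈ B, ∀ m, res x m ∈ D m) {n : ℕ} {x : ℕ → ℤ} (hx : x ∈ iterSum F B n) :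
    ∃ f ∈ F, ∀ m, res x m ∈ sumNodes (D m) (res f m) n := by
  induction n generalizing x with
  | zero => exact ⟨x, hx, fun m => by simp [sumNodes]⟩
  | succ n ih =>
    obtain ⟨y, hy, b, hb, rfl⟩ := hx
    obtain ⟨f, hf, h⟩ := ih hy
    refine ⟨f, hf, fun m => ?_⟩
    simp only [res_add]
    exact Finset.mem_image₂_of_mem (h m) (hD b hb m)

/-- If the sets `D m` contain the length-`m` initial segments of elements of `B`, and covers of `F`
have arbitrarily small sums weighted by `|D m| ^ n`, then `F + B + ⋯ + B` is fake null. -/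
lemma isFakeNull_iterSum {F B : Set (ℕ → ℤ)} {D : ℕ → Finset (List ℤ)}
    (hD : ∀ x ∈ B, ∀ m, res x m ∈ D m) (hlen : ∀ m, ∀ d ∈ D m, d.length = m) {n : ℕ}
    (h : ∀ ε : ℝ≥0∞, ε ≠ 0 → ∃ σ : ℕ → List ℤ,
      ∑' i, ((D (σ i).length).card : ℝ≥0∞) ^ n * weight (σ i) < ε ∧ F ⊆ ⋃ i, cyl (σ i)) :
    IsFakeNull (iterSum F B n) := by
  refine isFakeNull_of_countable_cover fun ε hε => ?_
  obtain ⟨σ, hlt, hcov⟩ := h ε hε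
  refine ⟨Σ i, {τ // τ ∈ sumNodes (D (σ i).length) (σ i) n}, inferInstance, fun p => p.2.1, ?_, ?_⟩
  · refine lt_of_le_of_lt ?_ hlt
    rw [ENNReal.tsum_sigma']
    refine ENNReal.tsum_le_tsum fun i => ?_
    have hw (τ : {τ // τ ∈ sumNodes (D (σ i).length) (σ i) n}) : weight τ.1 = weight (σ i) := by
      rw [weight, length_of_mem_sumNodes (hlen _) τ.2, weight]
    simp only [hw, tsum_fintype, Finset.sum_const, nsmul_eq_mul]
    gcongr
    simpa using mod_cast card_sumNodes_le (D (σ i).length) (σ i) n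
  · intro x hx
    obtain ⟨f, hf, hfx⟩ := exists_res_mem_sumNodes hD hx
    obtain ⟨i, hi⟩ := Set.mem_iUnion.1 (hcov hf)
    have hmem := hfx (σ i).length
    rw [show res f (σ i).length = σ i from hi] at hmem
    exact Set.mem_iUnion.2 ⟨⟨i, _, hmem⟩, by simp [cyl]⟩

/-! ### Slow growth -/

/-- A convergent series over `ι` stays convergent after multiplying it by all powers of a
sufficiently slowly growing function of `ℓ : ι → ℕ`. -/
lemma exists_slow_growth {ι : Type*} (a : ι → ℝ≥0∞) (ℓ : ι → ℕ) (ha : ∑' p, a p ≠ ∞) :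
    ∃ L : ℕ → ℕ, (∀ k, k ≤ L k) ∧ ∀ N : ℕ → ℕ, (∀ k m, m ≤ L k → N m ≤ 2 ^ k) →
      ∀ n, ∑' p, (N (ℓ p) : ℝ≥0∞) ^ n * a p ≠ ∞ := by
  classical
  have htail (k : ℕ) : ∃ L, k ≤ L ∧
      ∑' p, (if L < ℓ p then a p else 0) ≤ ENNReal.ofReal (1 / k.factorial) := by
    have hpos : 0 < ENNReal.ofReal (1 / k.factorial) := by
      simp [Nat.factorial_pos]
    obtain ⟨s, hs⟩ := ((ENNReal.tendsto_tsum_compl_atTop_zero ha).eventually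
      (ge_mem_nhds hpos)).exists
    refine ⟨s.sup ℓ + k, by omega, le_trans ?_ hs⟩
    refine le_of_le_of_eq ?_ (tsum_subtype {p | p ∉ s} a).symm
    refine ENNReal.tsum_le_tsum fun p => ?_
    by_cases hp : p ∈ s
    · have := Finset.le_sup (f := ℓ) hp
      simp [show ¬ s.sup ℓ + k < ℓ p by omega]
    · simp only [Set.indicator, Set.mem_ofPred_eq, hp, not_false_eq_true, if_true]
      split_ifs <;> simp
  choose L hkL hL using htail
  refine ⟨L, hkL, fun N hN n => ?_⟩
  have hpt (p : ι) : (N (ℓ p) : ℝ≥0∞) ^ n * a p ≤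
      a p + ∑' k, (2 ^ (k + 1)) ^ n * (if L k < ℓ p then a p else 0) := by
    have hex : ∃ k, ℓ p ≤ L k := ⟨_, hkL _⟩
    obtain ⟨k, hk⟩ : ∃ k, Nat.find hex = k := ⟨_, rfl⟩
    have hk' : ℓ p ≤ L k := hk ▸ Nat.find_spec hex
    have hNk : (N (ℓ p) : ℝ≥0∞) ≤ 2 ^ k := mod_cast hN k _ hk'
    cases k with
    | zero =>
      refine le_add_right ?_
      calc _ ≤ (1 : ℝ≥0∞) ^ n * a p := by gcongr; simpa using hNk
        _ = a p := by simp
    | succ k =>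
      have hlt : L k < ℓ p := not_le.1 (Nat.find_min hex (by omega))
      refine le_add_left (le_trans ?_ (ENNReal.le_tsum k))
      rw [if_pos hlt]
      gcongr
  refine ne_top_of_le_ne_top ?_ (ENNReal.tsum_le_tsum hpt)
  rw [ENNReal.tsum_add, ENNReal.tsum_comm]
  refine ENNReal.add_ne_top.2 ⟨ha, ?_⟩
  simp only [ENNReal.tsum_mul_left]
  have hbound (k : ℕ) :
      (2 ^ (k + 1)) ^ n * ∑' p, (if L k < ℓ p then a p else 0) ≤
        ENNReal.ofReal (2 ^ n * ((2 ^ n) ^ k / k.factorial)) := by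
    refine (mul_le_mul_right (hL k) _).trans_eq ?_
    rw [show ((2 : ℝ≥0∞) ^ (k + 1)) ^ n = ENNReal.ofReal ((2 ^ (k + 1)) ^ n) by
      rw [ENNReal.ofReal_pow (by positivity), ENNReal.ofReal_pow (by positivity)]; simp,
      ← ENNReal.ofReal_mul (by positivity)]
    congr 1
    ring
  refine ne_top_of_le_ne_top ?_ (ENNReal.tsum_le_tsum hbound)
  exact ((Real.summable_pow_div_factorial (2 ^ n)).mul_left (2 ^ n)).tsum_ofReal_ne_top

/-- For fake null `F`, all iterated sums of `F` with the branches of a sufficiently slowly growing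
tree are fake null. -/
lemma IsFakeNull.exists_level_bound {F : Set (ℕ → ℤ)} (hF : IsFakeNull F) :
    ∃ L : ℕ → ℕ, ∀ T : Set (List ℤ),
      (∀ k m, m ≤ L k → ∃ S : Finset (List ℤ), S.card ≤ 2 ^ k ∧
        ∀ ρ ∈ T, ρ.length = m → ρ ∈ S) →
      ∀ n, IsFakeNull (iterSum F (branches T) n) := by
  choose σ hσ hcov using fun j : ℕ => hF.exists_cover (show (0 : ℝ) < 1 / 2 ^ j by positivity)
  have hfin : ∑' p : ℕ × ℕ, weight (σ p.1 p.2) ≠ ∞ := by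
    rw [ENNReal.tsum_prod (f := fun j i => weight (σ j i))]
    refine ne_top_of_le_ne_top ?_ (ENNReal.tsum_le_tsum hσ)
    simp only [ofReal_one_div_two_pow, ENNReal.tsum_geometric_two]
    simp
  obtain ⟨L, hkL, hL⟩ := exists_slow_growth _ (fun p : ℕ × ℕ => (σ p.1 p.2).length) hfin
  refine ⟨L, fun T hT n => ?_⟩
  have hlev (m : ℕ) : {ρ | ρ ∈ T ∧ ρ.length = m}.Finite := by
    obtain ⟨S, -, hS⟩ := hT m m (hkL m)
    exact S.finite_toSet.subset fun ρ hρ => hS ρ hρ.1 hρ.2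
  let D (m : ℕ) : Finset (List ℤ) := (hlev m).toFinset
  have hsum := hL (fun m => (D m).card) (fun k m hm => by
    obtain ⟨S, hcard, hS⟩ := hT k m hm
    refine (Finset.card_le_card fun ρ hρ => ?_).trans hcard
    have hρ' := (hlev m).mem_toFinset.1 hρ
    exact hS ρ hρ'.1 hρ'.2) n
  rw [ENNReal.tsum_prod
    (f := fun j i => ((D (σ j i).length).card : ℝ≥0∞) ^ n * weight (σ j i))] at hsum
  refine isFakeNull_iterSum (B := branches T) (D := D)
    (fun x hx m => (hlev m).mem_toFinset.2 ⟨hx m, length_res x m⟩)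
    (fun m d hd => ((hlev m).mem_toFinset.1 hd).2) fun ε hε => ?_
  obtain ⟨j, hj⟩ := ((ENNReal.tendsto_atTop_zero_of_tsum_ne_top hsum).eventually
    (gt_mem_nhds (pos_iff_ne_zero.2 hε))).exists
  exact ⟨σ j, hj, hcov j⟩

/-! ### Fusion -/

/-- A binary branching scheme of finite sequences: the `k`-th front consists of sequences satisfying
`P k`, and each `σ` in it has two children in the next front, extending `σ` by different labels. -/
structure Fusion (P : ℕ → List ℤ → Prop) where
  root : List ℤ
  front : ℕ → Finset (List ℤ)
  label : ℕ → List ℤ → Bool → ℤ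
  child : ℕ → List ℤ → Bool → List ℤ
  front_zero : front 0 = {root}
  mem_front_succ : ∀ k τ, τ ∈ front (k + 1) ↔ ∃ σ ∈ front k, ∃ b, child k σ b = τ
  card_front_le : ∀ k, (front k).card ≤ 2 ^ k
  prop : ∀ k, ∀ σ ∈ front k, P k σ
  label_injective : ∀ k, ∀ σ ∈ front k, Function.Injective (label k σ)
  append_label_prefix : ∀ k, ∀ σ ∈ front k, ∀ b, σ ++ [label k σ b] <+: child k σ b

lemma nonempty_fusion {P : ℕ → List ℤ → Prop} {σ₀ : List ℤ} (h₀ : P 0 σ₀)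
    (hstep : ∀ k σ, P k σ → ∃ (l : Bool → ℤ) (c : Bool → List ℤ), Function.Injective l ∧
      ∀ b, P (k + 1) (c b) ∧ σ ++ [l b] <+: c b) : Nonempty (Fusion P) := by
  choose! l c hl hc using hstep
  let front : ℕ → Finset (List ℤ) := Nat.rec {σ₀} fun k S => Finset.image₂ (c k) S Finset.univ
  have hsucc (k : ℕ) : front (k + 1) = Finset.image₂ (c k) (front k) Finset.univ := rfl
  have hP (k : ℕ) : ∀ σ ∈ front k, P k σ := by
    induction k with
    | zero => intro σ hσ; rwa [Finset.mem_singleton.1 hσ]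
    | succ k ih =>
      intro τ hτ
      obtain ⟨σ, hσ, b, -, rfl⟩ := Finset.mem_image₂.1 (hsucc k ▸ hτ)
      exact (hc k σ (ih σ hσ) b).1
  exact ⟨{
    root := σ₀
    front := front
    label := l
    child := c
    front_zero := rfl
    mem_front_succ := fun k τ => by
      simp only [hsucc, Finset.mem_image₂, Finset.mem_univ, true_and]
    card_front_le := fun k => by
      induction k with
      | zero => exact (Finset.card_singleton σ₀).le
      | succ k ih =>
        rw [hsucc, pow_succ]
        exact (Finset.card_image₂_le _ _ _).trans (Nat.mul_le_mul_right _ ih)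
    prop := hP
    label_injective := fun k σ hσ => hl k σ (hP k σ hσ)
    append_label_prefix := fun k σ hσ b => (hc k σ (hP k σ hσ) b).2 }⟩

namespace Fusion

variable {P : ℕ → List ℤ → Prop} (f : Fusion P)

/-- The tree of initial segments of the fronts. -/
def tree : Set (List ℤ) := {ρ | ∃ k, ∃ σ ∈ f.front k, ρ <+: σ}

variable {f}

lemma child_mem {k : ℕ} {σ : List ℤ} (hσ : σ ∈ f.front k) (b : Bool) :
    f.child k σ b ∈ f.front (k + 1) := (f.mem_front_succ k _).2 ⟨σ, hσ, b, rfl⟩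

lemma prefix_child {k : ℕ} {σ : List ℤ} (hσ : σ ∈ f.front k) (b : Bool) :
    σ <+: f.child k σ b := (List.prefix_append _ _).trans (f.append_label_prefix k σ hσ b)

lemma exists_extension {j k : ℕ} (hjk : j ≤ k) {σ : List ℤ} (hσ : σ ∈ f.front j) :
    ∃ τ ∈ f.front k, σ <+: τ := by
  induction k, hjk using Nat.le_induction with
  | base => exact ⟨σ, hσ, List.prefix_rfl⟩
  | succ k _ ih =>
    obtain ⟨τ, hτ, h⟩ := ih
    exact ⟨_, child_mem hτ true, h.trans (prefix_child hτ true)⟩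

lemma exists_ancestor {j k : ℕ} (hjk : j ≤ k) {τ : List ℤ} (hτ : τ ∈ f.front k) :
    ∃ σ ∈ f.front j, σ <+: τ := by
  induction k, hjk using Nat.le_induction generalizing τ with
  | base => exact ⟨τ, hτ, List.prefix_rfl⟩
  | succ k _ ih =>
    obtain ⟨σ, hσ, b, rfl⟩ := (f.mem_front_succ k τ).1 hτ
    obtain ⟨ρ, hρ, h⟩ := ih hσ
    exact ⟨ρ, hρ, h.trans (prefix_child hσ b)⟩

lemma exists_prefix_of_length_le {ρ : List ℤ} (hρ : ρ ∈ f.tree) {k : ℕ}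
    (hk : ∀ σ ∈ f.front k, ρ.length ≤ σ.length) : ∃ σ ∈ f.front k, ρ <+: σ := by
  obtain ⟨j, σ, hσ, h⟩ := hρ
  rcases le_total j k with hjk | hkj
  · obtain ⟨τ, hτ, h'⟩ := exists_extension hjk hσ
    exact ⟨τ, hτ, h.trans h'⟩
  · obtain ⟨τ, hτ, h'⟩ := exists_ancestor hkj hσ
    exact ⟨τ, hτ, List.prefix_of_prefix_length_le h h' (hk τ hτ)⟩

lemma tree_subset {T : Set (List ℤ)} (hT : IsTree T) (hP : ∀ k σ, P k σ → σ ∈ T) :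
    f.tree ⊆ T := by
  rintro ρ ⟨k, σ, hσ, h⟩
  exact hT σ (hP k σ (f.prop k σ hσ)) ρ h

lemma splits_of_mem_front {k : ℕ} {σ : List ℤ} (hσ : σ ∈ f.front k) : Splits f.tree σ :=
  ⟨_, _, (f.label_injective k σ hσ).ne Bool.false_ne_true,
    ⟨k + 1, _, child_mem hσ _, f.append_label_prefix k σ hσ _⟩,
    ⟨k + 1, _, child_mem hσ _, f.append_label_prefix k σ hσ _⟩⟩

variable (f) in
lemma isPerfect_tree : IsPerfect f.tree := by
  refine ⟨?_, ⟨f.root, 0, f.root, by simp [f.front_zero], List.prefix_rfl⟩, ?_⟩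
  · rintro σ ⟨k, τ, hτ, h⟩ ρ hρ
    exact ⟨k, τ, hτ, hρ.trans h⟩
  · rintro ρ ⟨k, σ, hσ, h⟩
    exact ⟨σ, ⟨k, σ, hσ, List.prefix_rfl⟩, h, splits_of_mem_front hσ⟩

lemma exists_level_finset {k m : ℕ} (hk : ∀ σ, P k σ → m ≤ σ.length) :
    ∃ S : Finset (List ℤ), S.card ≤ 2 ^ k ∧ ∀ ρ ∈ f.tree, ρ.length = m → ρ ∈ S := by
  refine ⟨(f.front k).image (List.take m), Finset.card_image_le.trans (f.card_front_le k), ?_⟩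
  rintro ρ hρ rfl
  obtain ⟨σ, hσ, h⟩ := exists_prefix_of_length_le hρ fun σ hσ => hk σ (f.prop k σ hσ)
  exact Finset.mem_image.2 ⟨σ, hσ, (List.prefix_iff_eq_take.1 h).symm⟩

/-- If the length of the elements of each front is constant, the tree splits only at the fronts. -/
lemma not_splits_of_length_notMem_range {ℓ : ℕ → ℕ} (hℓ : StrictMono ℓ)
    (hP : ∀ k σ, P k σ → σ.length = ℓ k) {ρ : List ℤ} (hρ : ρ.length ∉ Set.range ℓ) :
    ¬ Splits f.tree ρ := by
  rintro ⟨i, j, hij, hi, hj⟩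
  have hlen {k : ℕ} {σ : List ℤ} (hσ : σ ∈ f.front k) : σ.length = ℓ k := hP k σ (f.prop k σ hσ)
  -- two immediate successors of a node lie below different elements of a front
  have hdiff {σ : List ℤ} (h : ρ ++ [i] <+: σ) (h' : ρ ++ [j] <+: σ) : False := by
    have := (List.prefix_of_prefix_length_le h h' (by simp)).eq_of_length (by simp)
    simp_all
  have hex : ∃ k, ρ.length ≤ ℓ k := ⟨_, hℓ.le_apply⟩
  obtain ⟨k, hk⟩ : ∃ k, Nat.find hex = k := ⟨_, rfl⟩
  have hle : ρ.length ≤ ℓ k := hk ▸ Nat.find_spec hex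
  have hlt : ρ.length < ℓ k := hle.lt_of_ne fun h => hρ ⟨k, h.symm⟩
  obtain ⟨σ, hσ, hiσ⟩ := exists_prefix_of_length_le hi (k := k) fun σ hσ => by simp [hlen hσ, hlt]
  obtain ⟨τ, hτ, hjτ⟩ := exists_prefix_of_length_le hj (k := k) fun σ hσ => by simp [hlen hσ, hlt]
  cases k with
  | zero =>
    rw [f.front_zero, Finset.mem_singleton] at hσ hτ
    exact hdiff hiσ (hσ.trans hτ.symm ▸ hjτ)
  | succ k =>
    have hklt : ℓ k < ρ.length := not_le.1 (Nat.find_min hex (by omega))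
    obtain ⟨σ', hσ', b, rfl⟩ := (f.mem_front_succ k σ).1 hσ
    obtain ⟨τ', hτ', c, rfl⟩ := (f.mem_front_succ k τ).1 hτ
    have hb : σ' ++ [f.label k σ' b] <+: ρ :=
      List.prefix_of_prefix_length_le (f.append_label_prefix k σ' hσ' b)
        ((List.prefix_append _ _).trans hiσ) (by simp [hlen hσ', hklt])
    have hc : τ' ++ [f.label k τ' c] <+: ρ :=
      List.prefix_of_prefix_length_le (f.append_label_prefix k τ' hτ' c)
        ((List.prefix_append _ _).trans hjτ) (by simp [hlen hτ', hklt])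
    have heq := (List.prefix_of_prefix_length_le hb hc (by simp [hlen hσ', hlen hτ'])).eq_of_length
      (by simp [hlen hσ', hlen hτ'])
    obtain ⟨rfl, hlab⟩ := List.append_inj heq (by simp [hlen hσ', hlen hτ'])
    obtain rfl := f.label_injective k σ' hσ' (List.singleton_injective hlab)
    exact hdiff hiσ hjτ

lemma isUniformlyPerfect_tree {ℓ : ℕ → ℕ} (hℓ : StrictMono ℓ)
    (hP : ∀ k σ, P k σ → σ.length = ℓ k) : IsUniformlyPerfect f.tree := by
  refine ⟨f.isPerfect_tree, fun n => ?_⟩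
  by_cases hn : n ∈ Set.range ℓ
  · obtain ⟨k, rfl⟩ := hn
    refine Or.inl fun ρ hρ hlen => ?_
    have hfront {σ : List ℤ} (hσ : σ ∈ f.front k) : ρ.length = σ.length := by
      rw [hlen, hP k σ (f.prop k σ hσ)]
    obtain ⟨σ, hσ, h⟩ := exists_prefix_of_length_le hρ fun σ hσ => (hfront hσ).le
    exact h.eq_of_length (hfront hσ) ▸ splits_of_mem_front hσ
  · exact Or.inr fun ρ _ hlen => not_splits_of_length_notMem_range hℓ hP (hlen ▸ hn)

end Fusion

/-! ### Extensions in perfect trees -/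

lemma IsPerfect.exists_splits_of_le_length {T : Set (List ℤ)} (hT : IsPerfect T) {σ : List ℤ}
    (hσ : σ ∈ T) (n : ℕ) : ∃ τ ∈ T, σ <+: τ ∧ Splits T τ ∧ n ≤ τ.length := by
  induction n with
  | zero =>
    obtain ⟨τ, hτ, h, hs⟩ := hT.2.2 σ hσ
    exact ⟨τ, hτ, h, hs, Nat.zero_le _⟩
  | succ n ih =>
    obtain ⟨τ, -, h, ⟨i, -, -, hi, -⟩, hn⟩ := ih
    obtain ⟨ρ, hρ, h', hs⟩ := hT.2.2 _ hi
    refine ⟨ρ, hρ, h.trans ((List.prefix_append _ _).trans h'), hs, ?_⟩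
    have := h'.length_le
    simp at this
    omega

lemma IsPerfect.exists_length_eq {T : Set (List ℤ)} (hT : IsPerfect T) {σ : List ℤ}
    (hσ : σ ∈ T) {n : ℕ} (hn : σ.length ≤ n) : ∃ τ ∈ T, σ <+: τ ∧ τ.length = n := by
  obtain ⟨τ, hτ, h, -, hle⟩ := hT.exists_splits_of_le_length hσ n
  refine ⟨τ.take n, hT.1 τ hτ _ (List.take_prefix _ _), ?_, by simpa using hle⟩
  exact List.prefix_of_prefix_length_le h (List.take_prefix _ _) (by simp [hn, hle])

lemma Splits.exists_injective {T : Set (List ℤ)} {σ : List ℤ} (h : Splits T σ) :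
    ∃ l : Bool → ℤ, Function.Injective l ∧ ∀ b, σ ++ [l b] ∈ T := by
  obtain ⟨i, j, hij, hi, hj⟩ := h
  refine ⟨fun b => cond b i j, ?_, ?_⟩
  · rintro (_ | _) (_ | _) hb <;> simp_all
  · rintro (_ | _) <;> assumption

lemma IsPerfect.nonempty_fusion {T : Set (List ℤ)} (hT : IsPerfect T) (L : ℕ → ℕ) :
    Nonempty (Fusion fun k σ => σ ∈ T ∧ Splits T σ ∧ L k ≤ σ.length) := by
  obtain ⟨σ, hσ⟩ := hT.2.1
  obtain ⟨τ, hτ, -, hs, hle⟩ := hT.exists_splits_of_le_length hσ (L 0)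
  refine _root_.nonempty_fusion ⟨hτ, hs, hle⟩ ?_
  rintro k σ ⟨-, hs, -⟩
  obtain ⟨l, hl, hmem⟩ := hs.exists_injective
  choose c hc using fun b => hT.exists_splits_of_le_length (hmem b) (L (k + 1))
  exact ⟨l, c, hl, fun b => ⟨⟨(hc b).1, (hc b).2.2⟩, (hc b).2.1⟩⟩

lemma IsUniformlyPerfect.exists_fusion {T : Set (List ℤ)} (hT : IsUniformlyPerfect T)
    (L : ℕ → ℕ) : ∃ ℓ : ℕ → ℕ, StrictMono ℓ ∧ (∀ k, L k ≤ ℓ k) ∧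
      Nonempty (Fusion fun k σ => σ ∈ T ∧ σ.length = ℓ k) := by
  obtain ⟨σ, hσ⟩ := hT.1.2.1
  have hfreq (k : ℕ) : ∃ᶠ n in atTop, L k ≤ n ∧ ∀ σ ∈ T, σ.length = n → Splits T σ := by
    refine frequently_atTop.2 fun N => ?_
    obtain ⟨τ, hτ, -, hs, hle⟩ := hT.1.exists_splits_of_le_length hσ (max N (L k))
    exact ⟨τ.length, (le_max_left _ _).trans hle, (le_max_right _ _).trans hle,
      (hT.2 τ.length).resolve_right fun h => h τ hτ rfl hs⟩
  obtain ⟨ℓ, hℓ, h⟩ := extraction_forall_of_frequently hfreq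
  refine ⟨ℓ, hℓ, fun k => (h k).1, ?_⟩
  obtain ⟨τ, hτ, -, hlen⟩ := hT.1.exists_length_eq
    (hT.1.1 σ hσ [] List.nil_prefix) (Nat.zero_le (ℓ 0))
  refine nonempty_fusion ⟨hτ, hlen⟩ ?_
  rintro k σ ⟨hσ, hlen⟩
  obtain ⟨l, hl, hmem⟩ := ((h k).2 σ hσ hlen).exists_injective
  choose c hc using fun b => hT.1.exists_length_eq (hmem b) (n := ℓ (k + 1))
    (by simpa [hlen] using hℓ k.lt_succ_self)
  exact ⟨l, c, hl, fun b => ⟨⟨(hc b).1, (hc b).2.2⟩, (hc b).2.1⟩⟩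

/-- For fake null `F` and a (uniformly) perfect tree `T` there is a
(uniformly) perfect `T' ⊆ T` with all `n`-fold sums `F + [T'] + ⋯ + [T']` fake null. -/
theorem stmt11 :
    (∀ F : Set (ℕ → ℤ), ∀ T : Set (List ℤ), IsFakeNull F → IsPerfect T →
      ∃ T' : Set (List ℤ), T' ⊆ T ∧ IsPerfect T' ∧
        ∀ n : ℕ, 1 ≤ n → IsFakeNull (iterSum F (branches T') n)) ∧
    (∀ F : Set (ℕ → ℤ), ∀ T : Set (List ℤ), IsFakeNull F → IsUniformlyPerfect T →
      ∃ T' : Set (List ℤ), T' ⊆ T ∧ IsUniformlyPerfect T' ∧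
        ∀ n : ℕ, 1 ≤ n → IsFakeNull (iterSum F (branches T') n)) := by
  refine ⟨fun F T hF hT => ?_, fun F T hF hT => ?_⟩
  · obtain ⟨L, hL⟩ := hF.exists_level_bound
    obtain ⟨f⟩ := hT.nonempty_fusion L
    refine ⟨f.tree, Fusion.tree_subset hT.1 fun _ _ h => h.1, f.isPerfect_tree, fun n _ => ?_⟩
    exact hL _ (fun k m hm => Fusion.exists_level_finset fun σ hσ => hm.trans hσ.2.2) n
  · obtain ⟨L, hL⟩ := hF.exists_level_bound
    obtain ⟨ℓ, hℓ, hLℓ, ⟨f⟩⟩ := hT.exists_fusion L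
    refine ⟨f.tree, Fusion.tree_subset hT.1.1 fun _ _ h => h.1,
      Fusion.isUniformlyPerfect_tree hℓ fun _ _ h => h.2, fun n _ => ?_⟩
    exact hL _ (fun k m hm => Fusion.exists_level_finset
      fun σ hσ => hm.trans ((hLℓ k).trans_eq hσ.2.symm)) n
end

section
/- There exists a comeager set G ⊆ ℤ^ω that is fake null; in particular, the σ-ideal of fake null sets is orthogonal to the σ-ideal of meager sets. -/
open Pointwise Filter

theorem isOpen_cyl (σ : List ℤ) : IsOpen (cyl σ) :=
  (isOpen_discrete {f : Fin σ.length → ℤ | List.ofFn f = σ}).preimage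
    (f := fun (x : ℕ → ℤ) (i : Fin σ.length) => x i) (by fun_prop)

/-- The sequence that agrees with `x` below `N` and vanishes from `N` on. -/
def truncate (x : ℕ → ℤ) (N : ℕ) : ℕ → ℤ := fun i => if i < N then x i else 0

theorem tendsto_truncate (x : ℕ → ℤ) : Tendsto (truncate x) atTop (nhds x) := by
  refine tendsto_pi_nhds.2 fun i => tendsto_const_nhds.congr' ?_
  filter_upwards [eventually_gt_atTop i] with N hN
  simp [truncate, hN]

theorem truncate_mem_cyl (x : ℕ → ℤ) (N m : ℕ) :
    truncate x N ∈ cyl (res x N ++ List.replicate m 0) := by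
  refine List.ext_getElem (by simp [res]) fun i h₁ h₂ => ?_
  simp [res, truncate, List.getElem_append]

/-- The `n`-th finite sequence of an enumeration, extended by `m` zeros. -/
noncomputable def paddedSeq (m n : ℕ) : List ℤ :=
  (exists_surjective_nat (List ℤ)).choose n ++ List.replicate m 0

theorem dense_iUnion_cyl_paddedSeq (m : ℕ → ℕ) : Dense (⋃ n, cyl (paddedSeq (m n) n)) := by
  refine fun x => mem_closure_of_tendsto (tendsto_truncate x) (Eventually.of_forall fun N => ?_)
  obtain ⟨n, hn⟩ := (exists_surjective_nat (List ℤ)).choose_spec (res x N)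
  refine Set.mem_iUnion.2 ⟨n, ?_⟩
  rw [paddedSeq, hn]
  exact truncate_mem_cyl x N (m n)

theorem one_div_two_pow_length_paddedSeq_le (k n : ℕ) :
    (1 : ℝ) / 2 ^ (paddedSeq (n + k + 1) n).length ≤ (1 / 2) ^ k / 2 / 2 ^ n := by
  calc (1 : ℝ) / 2 ^ (paddedSeq (n + k + 1) n).length ≤ 1 / 2 ^ (n + k + 1) := by
        gcongr
        · norm_num
        · simp [paddedSeq]
    _ = (1 / 2) ^ k / 2 / 2 ^ n := by
        rw [one_div_pow]
        field_simp
        ring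

/-- There is a comeager fake null set `G ⊆ ℤ^ω`. -/
theorem stmt18 : ∃ G : Set (ℕ → ℤ), IsMeagre Gᶜ ∧ IsFakeNull G := by
  refine ⟨⋂ k : ℕ, ⋃ n, cyl (paddedSeq (n + k + 1) n), ?_, fun ε hε => ?_⟩
  · rw [IsMeagre, compl_compl]
    exact countable_iInter_mem.2 fun k => residual_of_dense_open
      (isOpen_iUnion fun n => isOpen_cyl _) (dense_iUnion_cyl_paddedSeq fun n => n + k + 1)
  · obtain ⟨k, hk⟩ := exists_pow_lt_of_lt_one hε (one_half_lt_one (α := ℝ))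
    have hs : Summable fun n => (1 : ℝ) / 2 ^ (paddedSeq (n + k + 1) n).length :=
      (summable_geometric_two' ((1 / 2 : ℝ) ^ k)).of_nonneg_of_le (fun n => by positivity)
        (one_div_two_pow_length_paddedSeq_le k)
    refine ⟨fun n => paddedSeq (n + k + 1) n, hs, lt_of_le_of_lt ?_ hk, Set.iInter_subset _ k⟩
    exact (hs.tsum_le_tsum (one_div_two_pow_length_paddedSeq_le k)
      (summable_geometric_two' _)).trans_eq (tsum_geometric_two' _)
end
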